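/- arXiv:1101.5256 — 2 statements merged into one kernel-verified Lean document; each statement's English description precedes it below -/
import Mathlib

section
/- (Sharpness: inconsistency of the QCE method.) Let p ∈ [1,∞] with conjugate exponent p' = p/(p−1). For every A ∈ ℝ there exists a 2N-periodic displacement u ∈ 𝓤 with ‖u'‖_{ℓ^{p'}_ε({−N+1,…,N})} = 1 such that δE_qce(y_A)[u] − δE_a(y_A)[u] ≥ 2 · 4^{−1/p'} ε^{1/p} |φ₂'(2A)|, where y_A is the homogeneous deformation (y_A)_n := Aεn. In particular the dual norm ‖δE_qce(y_A) − δE_a(y_A)‖_{W^{−1,p}_ε} := sup{ δE_qce(y_A)[u] − δE_a(y_A)[u] : u ∈ 𝓤, ‖u'‖_{ℓ^{p'}_ε} = 1 } is at least 2 · 4^{−1/p'} ε^{1/p} |φ₂'(2A)|. -/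
open scoped BigOperators ENNReal NNReal

noncomputable section

/-- Backward difference `y'_n = (y_n − y_{n−1})/ε`. -/
def d1 (ε : ℝ) (y : ℤ → ℝ) (n : ℤ) : ℝ := (y n - y (n - 1)) / ε

/-- The full index range `{−N+1,…,N}`. -/
def rng (N : ℕ) : Finset ℤ := Finset.Icc (-(N : ℤ) + 1) (N : ℤ)

/-- The atomistic index set `𝓝_a = {−K,…,K}`. -/
def Na (K : ℕ) : Finset ℤ := Finset.Icc (-(K : ℤ)) (K : ℤ)

/-- The continuum index set `𝓝_c = {−N+1,…,N} \ 𝓝_a`. -/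
def Nc (N K : ℕ) : Finset ℤ := rng N \ Na K

/-- The 1D atomistic energy with first and second neighbour interactions. -/
def Ea1 (N : ℕ) (ε : ℝ) (φ1 φ2 : ℝ → ℝ) (y : ℤ → ℝ) : ℝ :=
  ε * ∑ n ∈ rng N, φ1 (d1 ε y n) + ε * ∑ n ∈ rng N, φ2 (d1 ε y n + d1 ε y (n + 1))

/-- The 1D QCE energy. -/
def Eqce (N K : ℕ) (ε : ℝ) (φ1 φ2 : ℝ → ℝ) (y : ℤ → ℝ) : ℝ :=
  ε * ∑ n ∈ Na K, (φ1 (d1 ε y n) + φ1 (d1 ε y (n + 1))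
      + φ2 (d1 ε y (n - 1) + d1 ε y n) + φ2 (d1 ε y (n + 1) + d1 ε y (n + 2))) / 2
    + ε * ∑ n ∈ Nc N K, (φ1 (d1 ε y n) + φ1 (d1 ε y (n + 1))
      + φ2 (2 * d1 ε y n) + φ2 (2 * d1 ε y (n + 1))) / 2

/-- The weighted `ℓ^p_ε` norm over an index set `S`, for `p ∈ [1,∞]`. -/
def lpNorm (ε : ℝ) (p : ℝ≥0∞) (S : Finset ℤ) (v : ℤ → ℝ) : ℝ :=
  if p = ∞ then ((S.sup fun n => ‖v n‖₊ : ℝ≥0) : ℝ)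
  else ε ^ (1 / p.toReal) * (∑ n ∈ S, |v n| ^ p.toReal) ^ (1 / p.toReal)

theorem sum_Icc_int_succ_sub (f : ℤ → ℝ) {a b : ℤ} (h : a ≤ b + 1) :
    ∑ n ∈ Finset.Icc a b, (f (n + 1) - f n) = f (b + 1) - f a := by
  obtain ⟨k, hk⟩ := Int.eq_ofNat_of_zero_le (sub_nonneg.2 h)
  induction k generalizing b with
  | zero =>
    obtain rfl : a = b + 1 := by omega
    simp
  | succ k ih =>
    have hb : Finset.Icc a b = insert b (Finset.Icc a (b - 1)) := by
      ext x
      simp only [Finset.mem_Icc, Finset.mem_insert]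
      omega
    rw [hb, Finset.sum_insert (by simp), ih (b := b - 1) (by omega) (by omega)]
    simp

theorem sum_rng_succ {N : ℕ} {f : ℤ → ℝ} (hf : ∀ n, f (n + 2 * N) = f n) :
    ∑ n ∈ rng N, f (n + 1) = ∑ n ∈ rng N, f n := by
  rw [← sub_eq_zero, ← Finset.sum_sub_distrib, rng, sum_Icc_int_succ_sub f (by omega),
    ← hf (-(N : ℤ) + 1), sub_eq_zero]
  congr 1
  ring

theorem d1_periodic {N : ℕ} {u : ℤ → ℝ} (hu : ∀ n, u (n + 2 * N) = u n) (ε : ℝ) (n : ℤ) :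
    d1 ε u (n + 2 * N) = d1 ε u n := by
  rw [d1, d1, hu, show n + 2 * (N : ℤ) - 1 = n - 1 + 2 * N by ring, hu]

theorem d1_homogeneous_add {ε : ℝ} (hε : ε ≠ 0) (A t : ℝ) (u : ℤ → ℝ) (n : ℤ) :
    d1 ε (fun n => A * (ε * n) + t * u n) n = A + t * d1 ε u n := by
  simp only [d1]
  push_cast
  field_simp
  ring

theorem hasDerivAt_comp_affine {φ : ℝ → ℝ} (hφ : ContDiff ℝ 1 φ) {g : ℝ → ℝ} (a b : ℝ)
    (hg : ∀ t, g t = a + t * b) :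
    HasDerivAt (fun t => φ (g t)) (deriv φ a * b) 0 := by
  have hg' : HasDerivAt g b 0 := by
    rw [show g = fun t => a + t * b from funext hg]
    simpa using ((hasDerivAt_id (0 : ℝ)).mul_const b).const_add a
  have h0 : g 0 = a := by simp [hg]
  have h := (hφ.differentiable one_ne_zero (g 0)).hasDerivAt
  rw [← h0]
  exact h.comp 0 hg'

theorem hasDerivAt_Ea1 {N : ℕ} {ε : ℝ} (hε : ε ≠ 0) {φ1 φ2 : ℝ → ℝ} (hφ1 : ContDiff ℝ 1 φ1)
    (hφ2 : ContDiff ℝ 1 φ2) (A : ℝ) (u : ℤ → ℝ) :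
    HasDerivAt (fun t : ℝ => Ea1 N ε φ1 φ2 (fun n => A * (ε * n) + t * u n))
      (ε * ∑ n ∈ rng N, deriv φ1 A * d1 ε u n
        + ε * ∑ n ∈ rng N, deriv φ2 (2 * A) * (d1 ε u n + d1 ε u (n + 1))) 0 := by
  simp only [Ea1, d1_homogeneous_add hε]
  refine ((HasDerivAt.fun_sum fun n _ => ?_).const_mul ε).add
    ((HasDerivAt.fun_sum fun n _ => ?_).const_mul ε)
  · exact hasDerivAt_comp_affine hφ1 _ _ fun t => rfl
  · exact hasDerivAt_comp_affine hφ2 _ _ fun t => by ring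

theorem hasDerivAt_Eqce {N K : ℕ} {ε : ℝ} (hε : ε ≠ 0) {φ1 φ2 : ℝ → ℝ} (hφ1 : ContDiff ℝ 1 φ1)
    (hφ2 : ContDiff ℝ 1 φ2) (A : ℝ) (u : ℤ → ℝ) :
    HasDerivAt (fun t : ℝ => Eqce N K ε φ1 φ2 (fun n => A * (ε * n) + t * u n))
      (ε * ∑ n ∈ Na K, (deriv φ1 A * d1 ε u n + deriv φ1 A * d1 ε u (n + 1)
          + deriv φ2 (2 * A) * (d1 ε u (n - 1) + d1 ε u n)
          + deriv φ2 (2 * A) * (d1 ε u (n + 1) + d1 ε u (n + 2))) / 2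
        + ε * ∑ n ∈ Nc N K, (deriv φ1 A * d1 ε u n + deriv φ1 A * d1 ε u (n + 1)
          + deriv φ2 (2 * A) * (2 * d1 ε u n)
          + deriv φ2 (2 * A) * (2 * d1 ε u (n + 1))) / 2) 0 := by
  simp only [Eqce, d1_homogeneous_add hε]
  refine ((HasDerivAt.fun_sum fun n _ => ?_).const_mul ε).add
    ((HasDerivAt.fun_sum fun n _ => ?_).const_mul ε) <;>
  · refine HasDerivAt.div_const (((HasDerivAt.add ?_ ?_).add ?_).add ?_) 2
    · exact hasDerivAt_comp_affine hφ1 _ _ fun t => rfl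
    · exact hasDerivAt_comp_affine hφ1 _ _ fun t => rfl
    · exact hasDerivAt_comp_affine hφ2 _ _ fun t => by ring
    · exact hasDerivAt_comp_affine hφ2 _ _ fun t => by ring

/-- At a homogeneous deformation only the strains next to the two interfaces contribute to the
first variation of `E_qce - E_a`. -/
theorem hasDerivAt_Eqce_sub_Ea1 {N K : ℕ} (hKN : K + 1 ≤ N) {ε : ℝ} (hε : ε ≠ 0)
    {φ1 φ2 : ℝ → ℝ} (hφ1 : ContDiff ℝ 1 φ1) (hφ2 : ContDiff ℝ 1 φ2) (A : ℝ) {u : ℤ → ℝ}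
    (hu : ∀ n, u (n + 2 * N) = u n) :
    HasDerivAt (fun t : ℝ => Eqce N K ε φ1 φ2 (fun n => A * (ε * n) + t * u n)
        - Ea1 N ε φ1 φ2 (fun n => A * (ε * n) + t * u n))
      (ε * deriv φ2 (2 * A) / 2 *
        (d1 ε u (-K - 1) - d1 ε u (-K + 1) - d1 ε u K + d1 ε u (K + 2))) 0 := by
  refine ((hasDerivAt_Eqce (N := N) (K := K) hε hφ1 hφ2 A u).fun_sub
    (hasDerivAt_Ea1 (N := N) hε hφ1 hφ2 A u)).congr_deriv ?_
  set v := d1 ε u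
  set a := deriv φ1 A
  set c := deriv φ2 (2 * A)
  have hsub : Na K ⊆ rng N := Finset.Icc_subset_Icc (by omega) (by omega)
  have hshift : ∑ n ∈ rng N, v (n + 1) = ∑ n ∈ rng N, v n := sum_rng_succ (d1_periodic hu ε)
  have hsplit (f : ℤ → ℝ) : ∑ n ∈ Nc N K, f n = ∑ n ∈ rng N, f n - ∑ n ∈ Na K, f n := by
    rw [Nc, ← Finset.sum_sdiff hsub, add_sub_cancel_right]
  have hleft : ∑ n ∈ Na K, v n - ∑ n ∈ Na K, v (n - 1) = v K - v (-K - 1) := by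
    rw [← Finset.sum_sub_distrib]
    simpa [Na] using sum_Icc_int_succ_sub (fun n => v (n - 1)) (a := -(K : ℤ)) (b := K) (by omega)
  have hright : ∑ n ∈ Na K, v (n + 2) - ∑ n ∈ Na K, v (n + 1) = v (K + 2) - v (-K + 1) := by
    rw [← Finset.sum_sub_distrib]
    simpa [Na, add_assoc] using
      sum_Icc_int_succ_sub (fun n => v (n + 1)) (a := -(K : ℤ)) (b := K) (by omega)
  simp only [hsplit, ← Finset.sum_div, Finset.sum_add_distrib, ← Finset.mul_sum, hshift]
  linear_combination ε * c / 2 * (hright - hleft)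

theorem lpNorm_eq_one_of_abs_eq_ite {ε : ℝ} (hε : 0 < ε) {q : ℝ≥0∞} (hq : q ≠ 0)
    {S T : Finset ℤ} (hTS : T ⊆ S) (hT : T.Nonempty) {v : ℤ → ℝ}
    (hv : ∀ n ∈ S, |v n| = if n ∈ T then (T.card * ε) ^ (-(1 / q).toReal) else 0) :
    lpNorm ε q S v = 1 := by
  have hc : (0 : ℝ) < T.card := by exact_mod_cast hT.card_pos
  rw [lpNorm]
  split_ifs with hq'
  · subst hq'
    simp only [ENNReal.div_top, ENNReal.toReal_zero, neg_zero, Real.rpow_zero] at hv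
    rw [NNReal.coe_eq_one]
    apply le_antisymm
    · refine Finset.sup_le fun n hn => ?_
      rw [← NNReal.coe_le_coe, coe_nnnorm, Real.norm_eq_abs, hv n hn, NNReal.coe_one]
      split_ifs <;> norm_num
    · obtain ⟨n, hn⟩ := hT
      refine le_trans (le_of_eq ?_) (Finset.le_sup (hTS hn))
      rw [← NNReal.coe_inj, coe_nnnorm, Real.norm_eq_abs, hv n (hTS hn), if_pos hn, NNReal.coe_one]
  · have hr : 0 < q.toReal := ENNReal.toReal_pos hq hq'
    have hpow : ∀ n ∈ S, |v n| ^ q.toReal = if n ∈ T then (T.card * ε)⁻¹ else 0 := by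
      intro n hn
      rw [hv n hn]
      split_ifs
      · rw [← Real.rpow_mul (by positivity), ENNReal.toReal_div, ENNReal.toReal_one, neg_mul,
          one_div_mul_cancel hr.ne', Real.rpow_neg_one]
      · exact Real.zero_rpow hr.ne'
    rw [Finset.sum_congr rfl hpow, Finset.sum_ite_mem, Finset.inter_eq_right.2 hTS,
      Finset.sum_const, nsmul_eq_mul, ← Real.mul_rpow hε.le (by positivity)]
    have : ε * (T.card * (T.card * ε)⁻¹) = 1 := by field_simp
    rw [this, Real.one_rpow]

/-- One period of the displacement whose strain is `b / ε` times `1, -1, -1, 1` at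
`-K - 1, -K + 1, K, K + 2`. -/
def interfaceBump (K : ℕ) (b : ℝ) (n : ℤ) : ℝ :=
  if n = -K - 1 ∨ n = -K then b else if n = K ∨ n = K + 1 then -b else 0

/-- The `2N`-periodic extension of `interfaceBump` from `{-N + 1, …, N}`. -/
def periodicBump (N K : ℕ) (b : ℝ) (n : ℤ) : ℝ :=
  interfaceBump K b ((n + N - 1) % (2 * N) - N + 1)

theorem periodicBump_add_period (N K : ℕ) (b : ℝ) (n : ℤ) :
    periodicBump N K b (n + 2 * N) = periodicBump N K b n := by
  rw [periodicBump, periodicBump, show n + 2 * (N : ℤ) + N - 1 = n + N - 1 + 2 * N by ring,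
    Int.add_emod_right]

theorem periodicBump_of_mem {N K : ℕ} (b : ℝ) {n : ℤ} (hn : n ∈ rng N) :
    periodicBump N K b n = interfaceBump K b n := by
  rw [rng, Finset.mem_Icc] at hn
  rw [periodicBump, Int.emod_eq_of_lt (by omega) (by omega)]
  congr 1
  ring

theorem d1_periodicBump {N K : ℕ} (hK : 1 ≤ K) (hKN : K + 2 ≤ N) (ε b : ℝ) {n : ℤ}
    (hn : n ∈ rng N) :
    d1 ε (periodicBump N K b) n = if n = -K - 1 ∨ n = K + 2 then b / ε
      else if n = -K + 1 ∨ n = K then -(b / ε) else 0 := by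
  have hpred : periodicBump N K b (n - 1) = interfaceBump K b (n - 1) := by
    by_cases h : n - 1 ∈ rng N
    · exact periodicBump_of_mem b h
    · obtain rfl : n = -N + 1 := by
        simp only [rng, Finset.mem_Icc] at h hn
        omega
      rw [← periodicBump_add_period, periodicBump_of_mem b (by simp [rng]; omega)]
      simp only [interfaceBump]
      split_ifs <;> first | rfl | omega
  rw [d1, periodicBump_of_mem b hn, hpred]
  simp only [interfaceBump]
  split_ifs <;> first | omega | ring

/-- Sharpness: inconsistency of the QCE method: there is a `2N`-periodic
displacement `u` with `‖u'‖_{ℓ^{p'}_ε} = 1` for which the first variation of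
`E_qce − E_a` at the homogeneous deformation `y_A` in direction `u` is at least
`2 · 4^{−1/p'} ε^{1/p} |φ₂'(2A)|`. -/
theorem stmt_7
    (N K : ℕ) (hN : 1 ≤ N) (hK1 : 1 ≤ K) (hK2 : K + 2 ≤ N)
    (φ1 φ2 : ℝ → ℝ) (hφ1 : ContDiff ℝ 1 φ1) (hφ2 : ContDiff ℝ 1 φ2)
    (p q : ℝ≥0∞) (hp : 1 ≤ p) (hq : 1 ≤ q) (hpq : 1 / p + 1 / q = 1)
    (A : ℝ) :
    ∃ (u : ℤ → ℝ) (D : ℝ),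
      (∀ n : ℤ, u (n + 2 * N) = u n) ∧
      lpNorm (1 / (N : ℝ)) q (rng N) (d1 (1 / (N : ℝ)) u) = 1 ∧
      HasDerivAt (fun t : ℝ =>
          Eqce N K (1 / (N : ℝ)) φ1 φ2 (fun n => A * ((1 / (N : ℝ)) * n) + t * u n)
            - Ea1 N (1 / (N : ℝ)) φ1 φ2 (fun n => A * ((1 / (N : ℝ)) * n) + t * u n)) D 0 ∧
      2 * (4 : ℝ) ^ (-(1 / q).toReal) * (1 / (N : ℝ)) ^ (1 / p).toReal
          * |deriv φ2 (2 * A)| ≤ D := by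
  have hN0 : (0 : ℝ) < N := by exact_mod_cast hN
  have hε : (0 : ℝ) < 1 / N := by positivity
  set ε : ℝ := 1 / N
  set s : ℝ := (4 * ε) ^ (-(1 / q).toReal) with hs
  have hs0 : 0 < s := by positivity
  obtain ⟨σ, hσ, hσφ⟩ : ∃ σ : ℝ, |σ| = 1 ∧ deriv φ2 (2 * A) * σ = |deriv φ2 (2 * A)| := by
    rcases abs_cases (deriv φ2 (2 * A)) with h | h
    · exact ⟨1, by simp, by linarith [h.1]⟩
    · exact ⟨-1, by simp, by linarith [h.1]⟩
  have hq0 : q ≠ 0 := (zero_lt_one.trans_le hq).ne'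
  have hp0 : p ≠ 0 := (zero_lt_one.trans_le hp).ne'
  have hexp : (1 / p).toReal = 1 - (1 / q).toReal := by
    rw [eq_sub_iff_add_eq, ← ENNReal.toReal_add (by simp [hp0]) (by simp [hq0]), hpq,
      ENNReal.toReal_one]
  have hstrain {n : ℤ} (hn : n ∈ rng N) := d1_periodicBump hK1 hK2 ε (ε * (σ * s)) hn
  simp only [mul_div_cancel_left₀ _ hε.ne'] at hstrain
  have hcard : ({-(K : ℤ) - 1, -(K : ℤ) + 1, (K : ℤ), (K : ℤ) + 2} : Finset ℤ).card = 4 := by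
    rw [Finset.card_insert_of_notMem, Finset.card_insert_of_notMem, Finset.card_pair]
    all_goals
      try simp only [Finset.mem_insert, Finset.mem_singleton]
      omega
  refine ⟨periodicBump N K (ε * (σ * s)), _, periodicBump_add_period N K _, ?_,
    hasDerivAt_Eqce_sub_Ea1 (by omega) hε.ne' hφ1 hφ2 A (periodicBump_add_period N K _), ?_⟩
  · refine lpNorm_eq_one_of_abs_eq_ite hε hq0
      (T := {-(K : ℤ) - 1, -(K : ℤ) + 1, (K : ℤ), (K : ℤ) + 2}) ?_ (by simp) fun n hn => ?_
    · intro n hn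
      simp only [Finset.mem_insert, Finset.mem_singleton] at hn
      rw [rng, Finset.mem_Icc]
      omega
    · rw [hcard, hstrain hn, Nat.cast_ofNat, ← hs]
      simp only [Finset.mem_insert, Finset.mem_singleton]
      split_ifs <;> first | omega | simp [abs_mul, hσ, abs_of_pos hs0]
  · have hmem {n : ℤ} (h₁ : -(N : ℤ) + 1 ≤ n) (h₂ : n ≤ N) : n ∈ rng N := Finset.mem_Icc.2 ⟨h₁, h₂⟩
    rw [hstrain (hmem (by omega) (by omega)), hstrain (hmem (by omega) (by omega)),
      hstrain (hmem (by omega) (by omega)), hstrain (hmem (by omega) (by omega)),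
      if_pos (by omega), if_neg (by omega), if_pos (by omega), if_neg (by omega),
      if_pos (by omega), if_pos (by omega), hexp, sub_eq_add_neg 1, Real.rpow_add hε,
      Real.rpow_one, ← hσφ, hs, Real.mul_rpow (by norm_num) hε.le]
    exact le_of_eq (by ring)
end
end

section
/- (Atomistic stress of a homogeneous deformation.) Let T ⊂ ℝ² be a nondegenerate triangle whose vertices belong to εℤ², and let F ∈ ℝ^{2×2}. Then Σ_{r∈ℛ} (ε²/|T|) Σ_{x∈εℤ²} [ ∂_r V(Fℛ) ⊗ r ] ⨍_x^{x+εr} χ_T db = Σ_{r∈ℛ} ∂_r V(Fℛ) ⊗ r; i.e., the atomistic stress Σ_a(y_F; T) of the homogeneous deformation y_F equals the gradient ∂W(F) of the Cauchy–Born stored energy W(F) := V(Fℛ). -/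
open scoped BigOperators RealInnerProductSpace
open MeasureTheory Filter

noncomputable section

/-- 2×2 real matrices, represented as the finite-dimensional space `Fin 2 → Fin 2 → ℝ`. -/
abbrev Mat2 := Fin 2 → Fin 2 → ℝ

/-- Real vector with coordinates `f`. -/
def toV2 (f : Fin 2 → ℝ) : EuclideanSpace ℝ (Fin 2) :=
  (WithLp.equiv 2 (Fin 2 → ℝ)).symm f

/-- The point `εz ∈ ℝ²` of the scaled lattice `εℤ²`. -/
def latpt (ε : ℝ) (z : Fin 2 → ℤ) : EuclideanSpace ℝ (Fin 2) :=
  toV2 fun i => ε * (z i : ℝ)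

/-- The integer vector `r` as a real vector. -/
def zvec (r : Fin 2 → ℤ) : EuclideanSpace ℝ (Fin 2) :=
  toV2 fun i => (r i : ℝ)

/-- The tensor product `a ⊗ r`, `(a ⊗ r)_{ij} = a_i r_j`. -/
def outer (a : EuclideanSpace ℝ (Fin 2)) (r : Fin 2 → ℤ) : Mat2 :=
  fun i j => (WithLp.equiv 2 (Fin 2 → ℝ)) a i * (r j : ℝ)

/-- The bond integral `⨍_x^{x+εr} χ db = ∫_0^1 χ((1−t)x + t(x+εr)) dt`. -/
def bondInt (ε : ℝ) (χ : EuclideanSpace ℝ (Fin 2) → ℝ) (x r : Fin 2 → ℤ) : ℝ :=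
  ∫ t in (0:ℝ)..1, χ (latpt ε x + t • (ε • zvec r))

/-- `χ` satisfies the defining density limit of `χ_T`. -/
def IsDensityFn (T : Set (EuclideanSpace ℝ (Fin 2))) (χ : EuclideanSpace ℝ (Fin 2) → ℝ) : Prop :=
  ∀ x : EuclideanSpace ℝ (Fin 2),
    Tendsto (fun t : ℝ =>
        (volume (T ∩ Metric.closedBall x t)).toReal / (volume (Metric.closedBall x t)).toReal)
      (nhdsWithin 0 (Set.Ioi 0)) (nhds (χ x))

/-- `Fℛ`: the stencil of the matrix `F`, i.e. `(Fr)_{r∈ℛ}`. -/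
def stencil (R : Finset (Fin 2 → ℤ)) (F : Mat2) : R → EuclideanSpace ℝ (Fin 2) :=
  fun r => toV2 fun i => ∑ j, F i j * ((r : Fin 2 → ℤ) j : ℝ)

section BondDensity

open Set Topology
open scoped ENNReal

section Lattice

variable {E G H : Type*} [AddCommGroup G] [AddCommGroup H]

/-- If `φ` reduces `E` modulo a subgroup of the lattice, the number of lattice translates of `x`
in the cell `φ = 0` does not depend on `x`. -/
theorem tsum_indicator_cell_eq [AddCommGroup E] (Λ : G →+ E) (ι : H →+ G) (φ : E → H)
    (hφ : ∀ x h, φ (x + Λ (ι h)) = φ x + h) (x x' : E) :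
    ∑' z, (φ ⁻¹' {0}).indicator (1 : E → ℝ≥0∞) (x + Λ z)
      = ∑' z, (φ ⁻¹' {0}).indicator (1 : E → ℝ≥0∞) (x' + Λ z) := by
  have key : ∀ x z h, φ (x + Λ (z + ι h)) = φ (x + Λ z) + h := fun x z h => by
    rw [map_add, ← add_assoc, hφ]
  have key' : ∀ x z h, φ (x + Λ (z - ι h)) = φ (x + Λ z) - h := fun x z h => by
    rw [sub_eq_add_neg, ← map_neg, key, sub_eq_add_neg]
  let e : {z | φ (x + Λ z) = 0} ≃ {z | φ (x' + Λ z) = 0} :=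
    { toFun := fun z => ⟨z - ι (φ (x' + Λ z)), by simp [key', -map_sub]⟩
      invFun := fun z => ⟨z - ι (φ (x + Λ z)), by simp [key', -map_sub]⟩
      left_inv := fun ⟨z, hz⟩ => by
        have hz' : φ (x + Λ z) = 0 := hz
        simp [key', hz', -map_sub]
      right_inv := fun ⟨z, hz⟩ => by
        have hz' : φ (x' + Λ z) = 0 := hz
        simp [key', hz', -map_sub] }
  have count : ∀ x, ∑' z, (φ ⁻¹' {0}).indicator (1 : E → ℝ≥0∞) (x + Λ z)
      = ∑' _ : {z | φ (x + Λ z) = 0}, (1 : ℝ≥0∞) := fun x => by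
    rw [tsum_subtype {z | φ (x + Λ z) = 0} (fun _ => (1 : ℝ≥0∞))]
    rfl
  rw [count, count, ← e.tsum_eq]

theorem tsum_measure_inter_fiber [AddCommGroup E] [MeasurableSpace E] [Countable G]
    (μ : Measure E) (Λ : G →+ E) (φ : E → G)
    (hφ : ∀ x z, φ (x + Λ z) = φ x + z) (hφm : ∀ z, MeasurableSet (φ ⁻¹' {z})) (P : Set E)
    (hP : MeasurableSet P) :
    ∑' z, μ (P ∩ {y | y - Λ z ∈ φ ⁻¹' {0}}) = μ P := by
  have h1 : ∀ z, {y | y - Λ z ∈ φ ⁻¹' {0}} = φ ⁻¹' {z} := fun z => by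
    ext y
    simp [sub_eq_add_neg, ← map_neg, hφ, add_neg_eq_zero]
  simp_rw [h1]
  rw [← measure_iUnion]
  · congr 1
    ext y
    simp
  · intro z z' hzz
    refine Set.disjoint_left.2 fun y hy hy' => hzz ?_
    exact hy.2.symm.trans hy'.2
  · exact fun z => hP.inter (hφm z)

/-- If every point has `m` lattice translates in `P`, the lattice translates of a set
meet `P` in total measure `m * μ S`. -/
theorem tsum_measure_inter_translate [NormedAddCommGroup E] [MeasurableSpace E] [BorelSpace E]
    [SecondCountableTopology E] [Countable G] (μ : Measure E) [μ.IsAddRightInvariant] (Λ : G →+ E) {P S : Set E} (hP : MeasurableSet P)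
    {m : ℝ≥0∞} (hm : ∀ x, ∑' z, P.indicator (1 : E → ℝ≥0∞) (x + Λ z) = m) :
    ∑' z, μ (P ∩ {y | y - Λ z ∈ S}) = m * μ S := by
  have h1 : ∀ z, μ (P ∩ {y | y - Λ z ∈ S})
      = ∫⁻ x in S, P.indicator (1 : E → ℝ≥0∞) (x + Λ z) ∂μ := fun z => by
    have hPz : MeasurableSet ((· + Λ z) ⁻¹' P) := measurable_add_const _ hP
    rw [← measure_preimage_add_right μ (Λ z)]
    have h2 : (fun h => h + Λ z) ⁻¹' (P ∩ {y | y - Λ z ∈ S}) = ((· + Λ z) ⁻¹' P) ∩ S := by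
      ext y; simp
    rw [h2, ← Measure.restrict_apply hPz, ← lintegral_indicator_one hPz]
    rfl
  simp_rw [h1]
  have h3 : ∀ z, Measurable fun x => P.indicator (1 : E → ℝ≥0∞) (x + Λ z) := fun z =>
    (measurable_one.indicator hP).comp (measurable_add_const _)
  rw [← lintegral_tsum fun z => (h3 z).aemeasurable]
  simp [hm]

end Lattice

section Density

theorem IsDensityFn.mem_Icc {T : Set (EuclideanSpace ℝ (Fin 2))}
    {χ : EuclideanSpace ℝ (Fin 2) → ℝ} (hχ : IsDensityFn T χ) (x) : χ x ∈ Icc (0 : ℝ) 1 := by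
  refine isClosed_Icc.mem_of_tendsto (hχ x) (Eventually.of_forall fun t => ⟨by positivity, ?_⟩)
  refine div_le_one_of_le₀ (ENNReal.toReal_mono ?_ (measure_mono inter_subset_right))
    ENNReal.toReal_nonneg
  exact (isCompact_closedBall x t).measure_lt_top.ne

theorem IsDensityFn.measurable {T : Set (EuclideanSpace ℝ (Fin 2))}
    {χ : EuclideanSpace ℝ (Fin 2) → ℝ} (hχ : IsDensityFn T χ) (hT : MeasurableSet T) :
    Measurable χ := by
  have hlim : Tendsto (fun n : ℕ => 1 / ((n : ℝ) + 1)) atTop (𝓝[>] 0) :=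
    tendsto_nhdsWithin_iff.2 ⟨tendsto_one_div_add_atTop_nhds_zero_nat,
      Eventually.of_forall fun n => by simp only [mem_Ioi]; positivity⟩
  refine measurable_of_tendsto_metrizable (fun n => ?_)
    (tendsto_pi_nhds.2 fun x => (hχ x).comp hlim)
  have h : ∀ S : Set (EuclideanSpace ℝ (Fin 2)), MeasurableSet S → ∀ t : ℝ,
      Measurable fun x => volume (S ∩ Metric.closedBall x t) := fun S hS t =>
    measurable_measure_prodMk_left (ν := volume)
      (s := {q : EuclideanSpace ℝ (Fin 2) × EuclideanSpace ℝ (Fin 2) |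
        q.2 ∈ S ∧ dist q.2 q.1 ≤ t})
      ((measurable_snd hS).inter
        (measurableSet_le (measurable_snd.dist measurable_fst) measurable_const))
  have h' := h univ MeasurableSet.univ (1 / ((n : ℝ) + 1))
  simp only [univ_inter] at h'
  exact (h T hT _).ennreal_toReal.div h'.ennreal_toReal

end Density

section Reflection

variable {E : Type*} [NormedAddCommGroup E] [NormedSpace ℝ E]

theorem AffineBasis.coord_add_smul_sub {ι : Type*} (B : AffineBasis ι ℝ E) (k i j : ι) (x : E)
    (t : ℝ) : B.coord k (x + t • (B i - B j)) = B.coord k x + t * (B.coord k (B i) - B.coord k (B j))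
    := by
  have h1 := (B.coord k).map_vadd x (t • (B i - B j))
  have h2 := (B.coord k).linearMap_vsub (B i) (B j)
  simp only [vsub_eq_sub] at h2
  rw [map_smul, h2, vadd_eq_add, vadd_eq_add, smul_eq_mul] at h1
  rw [add_comm x, h1, add_comm]

theorem AffineBasis.coord_add_sub {ι : Type*} (B : AffineBasis ι ℝ E) (k i j : ι) (x : E) :
    B.coord k (B i + B j - x) = B.coord k (B i) + B.coord k (B j) - B.coord k x := by
  have h1 := (B.coord k).map_vadd (B i) (B j - x)
  have h2 := (B.coord k).linearMap_vsub (B j) x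
  simp only [vsub_eq_sub] at h2
  rw [h2, vadd_eq_add, vadd_eq_add] at h1
  rw [show B i + B j - x = B j - x + B i by abel, h1]
  ring

theorem AffineBasis.coord_sum_three (B : AffineBasis (Fin 3) ℝ E) (x : E) :
    B.coord 0 x + B.coord 1 x + B.coord 2 x = 1 := by
  rw [← B.sum_coord_apply_eq_one x, Fin.sum_univ_three]

/-- Integer parts of the coordinates with respect to the edges `B 1 - B 0` and `B 2 - B 0`. -/
def AffineBasis.floorCoord (B : AffineBasis (Fin 3) ℝ E) (x : E) : ℤ × ℤ :=
  (⌊B.coord 1 x⌋, ⌊B.coord 2 x⌋)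

theorem AffineBasis.floorCoord_eq_zero_iff (B : AffineBasis (Fin 3) ℝ E) (x : E) :
    B.floorCoord x = 0 ↔
      (0 ≤ B.coord 1 x ∧ B.coord 1 x < 1) ∧ (0 ≤ B.coord 2 x ∧ B.coord 2 x < 1) := by
  simp only [AffineBasis.floorCoord, Prod.mk_eq_zero, Int.floor_eq_zero_iff, mem_Ico]

theorem AffineBasis.floorCoord_add (B : AffineBasis (Fin 3) ℝ E) (x : E) (h : ℤ × ℤ) :
    B.floorCoord (x + ((h.1 : ℝ) • (B 1 - B 0) + (h.2 : ℝ) • (B 2 - B 0)))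
      = B.floorCoord x + h := by
  rw [← add_assoc]
  simp only [AffineBasis.floorCoord, AffineBasis.coord_add_smul_sub]
  ext <;> simp

theorem AffineBasis.isBounded_floorCoord_fiber (B : AffineBasis (Fin 3) ℝ E) :
    Bornology.IsBounded (B.floorCoord ⁻¹' {0}) := by
  have hT : Bornology.IsBounded (convexHull ℝ (range B)) :=
    ((finite_range B).isCompact_convexHull ℝ).isBounded
  have hT' : Bornology.IsBounded ((fun y => B 1 + B 2 - y) '' convexHull ℝ (range B)) :=
    (((finite_range B).isCompact_convexHull ℝ).image (by fun_prop)).isBounded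
  refine (hT.union hT').subset fun y hy => ?_
  obtain ⟨⟨h1, h1'⟩, h2, h2'⟩ := (B.floorCoord_eq_zero_iff y).1 hy
  have h0 := B.coord_sum_three y
  rcases le_total 0 (B.coord 0 y) with h | h
  · left
    rw [B.convexHull_eq_nonneg_coord]
    intro i
    fin_cases i <;> assumption
  · right
    refine ⟨B 1 + B 2 - y, ?_, by simp⟩
    rw [B.convexHull_eq_nonneg_coord]
    intro i
    rw [B.coord_add_sub]
    fin_cases i <;> simp <;> linarith

theorem AffineBasis.measurableSet_convexHull {ι : Type*} [MeasurableSpace E] [BorelSpace E] [Finite ι]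
    (B : AffineBasis ι ℝ E) :
    MeasurableSet (convexHull ℝ (range B)) :=
  ((finite_range B).isCompact_convexHull ℝ).isClosed.measurableSet

variable [FiniteDimensional ℝ E] [MeasurableSpace E] [BorelSpace E]

theorem AffineBasis.measurable_coord {ι : Type*} (B : AffineBasis ι ℝ E) (i : ι) :
    Measurable (B.coord i) :=
  (B.coord i).continuous_of_finiteDimensional.measurable

theorem AffineBasis.measurableSet_floorCoord_fiber (B : AffineBasis (Fin 3) ℝ E) :
    MeasurableSet (B.floorCoord ⁻¹' {0}) := by
  have h : Measurable B.floorCoord :=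
    ((B.measurable_coord 1).floor).prodMk ((B.measurable_coord 2).floor)
  exact h (measurableSet_singleton 0)

variable (μ : Measure E) [μ.IsAddHaarMeasure]

theorem AffineBasis.measure_coord_eq_zero {ι : Type*} (B : AffineBasis ι ℝ E) (i j : ι) (t : ℝ)
    (h : B.coord i (B j) ≠ t) : μ {y | B.coord i y = t} = 0 := by
  have key := Measure.addHaar_affineSubspace μ ((affineSpan ℝ {t}).comap (B.coord i)) fun htop => by
    have : B j ∈ (affineSpan ℝ {t}).comap (B.coord i) := htop ▸ AffineSubspace.mem_top ℝ E (B j)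
    rw [AffineSubspace.mem_comap, AffineSubspace.mem_affineSpan_singleton] at this
    exact h this
  rwa [AffineSubspace.coe_comap, AffineSubspace.coe_affineSpan_singleton] at key

/-- A triangle and its reflection through the midpoint of an edge tile a parallelogram. -/
theorem AffineBasis.measure_inter_add_reflect (B : AffineBasis (Fin 3) ℝ E) {S : Set E}
    (hS : MeasurableSet S) :
    μ (convexHull ℝ (range B) ∩ S)
        + μ (convexHull ℝ (range B) ∩ (fun y => B 1 + B 2 - y) ⁻¹' S)
      = μ (B.floorCoord ⁻¹' {0} ∩ S) := by
  set T := convexHull ℝ (range B) with hTdef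
  have hT : MeasurableSet T := B.measurableSet_convexHull
  have hmp := Measure.measurePreserving_sub_left μ (B 1 + B 2)
  set T' := (fun y => B 1 + B 2 - y) ⁻¹' T
  have hT' : MeasurableSet T' := hmp.measurable hT
  have h1 : μ (T ∩ (fun y => B 1 + B 2 - y) ⁻¹' S) = μ (T' ∩ S) := by
    rw [← hmp.measure_preimage (hT.inter (hmp.measurable hS)).nullMeasurableSet]
    congr 1
    ext y
    simp [T']
  set Z := {y | B.coord 0 y = 0} ∪ ({y | B.coord 1 y = 1} ∪ {y | B.coord 2 y = 1}) with hZdef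
  have hZ : μ Z = 0 := by
    refine measure_union_null (B.measure_coord_eq_zero μ 0 0 0 ?_)
      (measure_union_null (B.measure_coord_eq_zero μ 1 0 1 ?_)
        (B.measure_coord_eq_zero μ 2 0 1 ?_)) <;> simp
  have hZm : MeasurableSet Z :=
    (B.measurable_coord 0 (measurableSet_singleton 0)).union
      ((B.measurable_coord 1 (measurableSet_singleton 1)).union
        (B.measurable_coord 2 (measurableSet_singleton 1)))
  have memT : ∀ y, y ∈ T ↔ 0 ≤ B.coord 0 y ∧ 0 ≤ B.coord 1 y ∧ 0 ≤ B.coord 2 y := fun y => by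
    rw [hTdef, B.convexHull_eq_nonneg_coord]
    simp [Fin.forall_fin_succ]
  have memT' : ∀ y, y ∈ T' ↔ B.coord 0 y ≤ 0 ∧ B.coord 1 y ≤ 1 ∧ B.coord 2 y ≤ 1 := fun y => by
    simp only [T', mem_preimage, memT, B.coord_add_sub]
    simp
  rw [h1, ← measure_sdiff_null (s := T ∩ S) hZ, ← measure_sdiff_null (s := T' ∩ S) hZ,
    ← measure_sdiff_null (s := B.floorCoord ⁻¹' {0} ∩ S) hZ, ← measure_union]
  · congr 1
    ext y
    have h0 := B.coord_sum_three y
    simp only [mem_union, Set.mem_sdiff, mem_inter_iff, mem_preimage, mem_singleton_iff, memT, memT',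
      B.floorCoord_eq_zero_iff, hZdef, mem_ofPred_eq, not_or]
    constructor
    · rintro (⟨⟨⟨a0, a1, a2⟩, hs⟩, n0, n1, n2⟩ | ⟨⟨⟨a0, a1, a2⟩, hs⟩, n0, n1, n2⟩)
      · have := lt_of_le_of_ne a0 (Ne.symm n0)
        exact ⟨⟨⟨⟨a1, by linarith⟩, a2, by linarith⟩, hs⟩, n0, n1, n2⟩
      · have := lt_of_le_of_ne a1 n1
        have := lt_of_le_of_ne a2 n2
        exact ⟨⟨⟨⟨by linarith, by assumption⟩, by linarith, by assumption⟩, hs⟩, n0, n1, n2⟩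
    · rintro ⟨⟨⟨⟨a1, a1'⟩, a2, a2'⟩, hs⟩, n⟩
      rcases le_total 0 (B.coord 0 y) with h | h
      · exact Or.inl ⟨⟨⟨h, a1, a2⟩, hs⟩, n⟩
      · exact Or.inr ⟨⟨⟨h, a1'.le, a2'.le⟩, hs⟩, n⟩
  · refine Set.disjoint_left.2 fun y hy hy' => hy.2 (Or.inl ?_)
    exact le_antisymm ((memT' y).1 hy'.1.1).1 ((memT y).1 hy.1.1).1
  · exact (hT'.inter hS).diff hZm

end Reflection

section Plane

theorem latpt_apply (ε : ℝ) (z : Fin 2 → ℤ) (i : Fin 2) : latpt ε z i = ε * z i := rfl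

/-- `latpt` as a homomorphism. -/
def latptHom (ε : ℝ) : (Fin 2 → ℤ) →+ EuclideanSpace ℝ (Fin 2) where
  toFun := latpt ε
  map_zero' := by ext i; simp [latpt_apply]
  map_add' z z' := by ext i; simp [latpt_apply, mul_add]

theorem latptHom_apply (ε : ℝ) (z : Fin 2 → ℤ) : latptHom ε z = latpt ε z := rfl

theorem smul_zvec (ε : ℝ) (r : Fin 2 → ℤ) : ε • zvec r = latptHom ε r := by
  ext i; simp [latptHom_apply, latpt, zvec, toV2]

theorem finite_norm_latptHom_le {ε : ℝ} (hε : 0 < ε) (ρ : ℝ) :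
    {z | ‖latptHom ε z‖ ≤ ρ}.Finite := by
  refine (finite_Icc (fun _ => -⌈ρ / ε⌉ : Fin 2 → ℤ) (fun _ => ⌈ρ / ε⌉)).subset fun z hz => ?_
  have key : ∀ i, |z i| ≤ ⌈ρ / ε⌉ := fun i => by
    have h1 : ‖latpt ε z i‖ ≤ ρ := (PiLp.norm_apply_le _ i).trans hz
    rw [latpt_apply, Real.norm_eq_abs, abs_mul, abs_of_pos hε, mul_comm, ← le_div_iff₀ hε] at h1
    exact_mod_cast h1.trans (Int.le_ceil _)
  exact ⟨fun i => (abs_le.1 (key i)).1, fun i => (abs_le.1 (key i)).2⟩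

theorem measure_latticeCell {ε : ℝ} (hε : 0 < ε) :
    volume ((fun (x : EuclideanSpace ℝ (Fin 2)) (i : Fin 2) => ⌊x i / ε⌋) ⁻¹' {0})
      = ENNReal.ofReal (ε ^ 2) := by
  have h : (fun (x : EuclideanSpace ℝ (Fin 2)) (i : Fin 2) => ⌊x i / ε⌋) ⁻¹' {0}
      = WithLp.ofLp ⁻¹' (Set.univ.pi fun _ => Ico (0 : ℝ) ε) := by
    ext x
    simp [funext_iff, Int.floor_eq_zero_iff, div_lt_one hε, div_nonneg_iff, hε.le, hε.not_ge]
  rw [h, (PiLp.volume_preserving_ofLp (Fin 2)).measure_preimage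
    (MeasurableSet.univ_pi fun _ => measurableSet_Ico).nullMeasurableSet, Real.volume_pi_Ico]
  simp [ENNReal.ofReal_mul hε.le, sq]

theorem exists_finset_inter_closedBall_eq_empty {ε : ℝ} (hε : 0 < ε)
    {T : Set (EuclideanSpace ℝ (Fin 2))} (hT : Bornology.IsBounded T) (ρ : ℝ) :
    ∃ K : Finset (Fin 2 → ℤ), ∀ z ∉ K, ∀ p, ‖p‖ ≤ ρ → ∀ t ≤ 1,
      T ∩ Metric.closedBall (p + latptHom ε z) t = ∅ := by
  obtain ⟨M, hM⟩ := hT.subset_closedBall 0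
  refine ⟨(finite_norm_latptHom_le hε (M + 1 + ρ)).toFinset, fun z hz p hp t ht => ?_⟩
  refine eq_empty_of_forall_notMem fun y hy => hz ?_
  have h1 : ‖y‖ ≤ M := by simpa using hM hy.1
  have h2 : ‖y - (p + latptHom ε z)‖ ≤ t := by simpa [dist_eq_norm] using hy.2
  have h3 : ‖latptHom ε z‖ ≤ ‖y - (y - (p + latptHom ε z))‖ + ‖p‖ := by
    refine (norm_sub_le _ p).trans' (le_of_eq ?_)
    congr 1
    abel
  have h4 := norm_sub_le y (y - (p + latptHom ε z))
  simp only [Finite.mem_toFinset, mem_ofPred_eq]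
  linarith

variable {T : Set (EuclideanSpace ℝ (Fin 2))} {χ : EuclideanSpace ℝ (Fin 2) → ℝ}

theorem IsDensityFn.exists_finset_eq_zero (hχ : IsDensityFn T χ) {ε : ℝ} (hε : 0 < ε)
    (hT : Bornology.IsBounded T) (ρ : ℝ) :
    ∃ K : Finset (Fin 2 → ℤ), ∀ z ∉ K, ∀ p, ‖p‖ ≤ ρ → χ (p + latptHom ε z) = 0 := by
  obtain ⟨K, hK⟩ := exists_finset_inter_closedBall_eq_empty hε hT ρ
  refine ⟨K, fun z hz p hp => tendsto_nhds_unique (hχ _) (tendsto_const_nhds.congr' ?_)⟩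
  filter_upwards [Ioc_mem_nhdsGT one_pos] with t ht
  simp [hK z hz p hp t ht.2]

theorem IsDensityFn.summable (hχ : IsDensityFn T χ) {ε : ℝ} (hε : 0 < ε)
    (hT : Bornology.IsBounded T) (p : EuclideanSpace ℝ (Fin 2)) :
    Summable fun z => χ (p + latptHom ε z) := by
  obtain ⟨K, hK⟩ := hχ.exists_finset_eq_zero hε hT ‖p‖
  exact summable_of_ne_finset_zero fun z hz => hK z hz p le_rfl

/-- If every point has `m` lattice translates in `T`, then it still has `m` of them when the
translates are counted with density. -/
theorem IsDensityFn.tsum_eq (hχ : IsDensityFn T χ) {ε : ℝ} (hε : 0 < ε)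
    (hT : Bornology.IsBounded T) (hTm : MeasurableSet T) {m : ℝ≥0∞}
    (hm : ∀ x, ∑' z, T.indicator (1 : EuclideanSpace ℝ (Fin 2) → ℝ≥0∞) (x + latptHom ε z) = m)
    (p : EuclideanSpace ℝ (Fin 2)) :
    ∑' z, χ (p + latptHom ε z) = m.toReal := by
  obtain ⟨K, hK⟩ := exists_finset_inter_closedBall_eq_empty hε hT ‖p‖
  obtain ⟨K', hK'⟩ := hχ.exists_finset_eq_zero hε hT ‖p‖
  classical
  rw [tsum_eq_sum (s := K ∪ K') fun z hz =>
    hK' z (fun h => hz (Finset.mem_union_right _ h)) p le_rfl]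
  refine tendsto_nhds_unique (tendsto_finsetSum _ fun z _ => hχ (p + latptHom ε z))
    (tendsto_const_nhds.congr' ?_)
  filter_upwards [Ioc_mem_nhdsGT one_pos] with t ht
  have hball : ∀ z, {y | y - latptHom ε z ∈ Metric.closedBall p t}
      = Metric.closedBall (p + latptHom ε z) t := fun z => by
    ext y
    simp [dist_eq_norm, sub_sub, add_comm]
  have h1 := tsum_measure_inter_translate volume (latptHom ε) hTm
    (S := Metric.closedBall p t) hm
  simp_rw [hball] at h1
  rw [tsum_eq_sum (s := K ∪ K') fun z hz => by
    rw [hK z (fun h => hz (Finset.mem_union_left _ h)) p le_rfl t ht.2, measure_empty]] at h1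
  have h2 : (volume (Metric.closedBall p t)).toReal ≠ 0 :=
    (ENNReal.toReal_pos (Metric.measure_closedBall_pos volume p ht.1).ne'
      (isCompact_closedBall p t).measure_lt_top.ne).ne'
  have hfin : ∀ z, volume (T ∩ Metric.closedBall (p + latptHom ε z) t) ≠ ∞ := fun z =>
    ((measure_mono inter_subset_right).trans_lt (isCompact_closedBall _ t).measure_lt_top).ne
  have h3 : ∀ z, volume (Metric.closedBall (p + latptHom ε z) t)
      = volume (Metric.closedBall p t) := fun z => by
    rw [Measure.addHaar_closedBall_center, Measure.addHaar_closedBall_center volume p]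
  simp_rw [h3]
  rw [← Finset.sum_div, ← ENNReal.toReal_sum fun z _ => hfin z, h1, ENNReal.toReal_mul,
    mul_div_cancel_right₀ _ h2]

/-- The bond integrals over all lattice translates of a bond add up to half of `m` if the densities
of all lattice translates of `p` and `-p` add up to `m`. -/
theorem IsDensityFn.tsum_bondInt (hχ : IsDensityFn T χ) {ε : ℝ} (hε : 0 < ε)
    (hT : Bornology.IsBounded T) (hTm : MeasurableSet T) {m : ℝ}
    (hm : ∀ p, ∑' z, χ (p + latptHom ε z) + ∑' z, χ (-p + latptHom ε z) = m) (r : Fin 2 → ℤ) :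
    HasSum (fun x => bondInt ε χ x r) (m / 2) := by
  obtain ⟨K, hK⟩ := hχ.exists_finset_eq_zero hε hT ‖latptHom ε r‖
  have hb : ∀ x, bondInt ε χ x r = ∫ t in (0 : ℝ)..1, χ (t • latptHom ε r + latptHom ε x) :=
    fun x => by simp only [bondInt, smul_zvec, latptHom_apply, add_comm]
  have hnorm : ∀ t ∈ Icc (0 : ℝ) 1, ‖t • latptHom ε r‖ ≤ ‖latptHom ε r‖ := fun t ht => by
    rw [norm_smul, Real.norm_of_nonneg ht.1]
    exact mul_le_of_le_one_left (norm_nonneg _) ht.2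
  have hint : ∀ x, IntervalIntegrable (fun t : ℝ => χ (t • latptHom ε r + latptHom ε x)) volume 0 1
      := fun x => by
    refine (intervalIntegrable_const (c := (1 : ℝ))).mono_fun
      ((hχ.measurable hTm).comp (by fun_prop)).aestronglyMeasurable
      (Eventually.of_forall fun t => ?_)
    have := hχ.mem_Icc (t • latptHom ε r + latptHom ε x)
    simpa [abs_of_nonneg this.1] using this.2
  set f : ℝ → ℝ := fun t => ∑' z, χ (t • latptHom ε r + latptHom ε z) with hf
  have hfK : EqOn f (fun t => ∑ z ∈ K, χ (t • latptHom ε r + latptHom ε z)) (uIcc 0 1) :=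
    fun t ht => tsum_eq_sum fun z hz => hK z hz _ (hnorm t (by rwa [uIcc_of_le zero_le_one] at ht))
  have hsum : ∑ x ∈ K, bondInt ε χ x r = ∫ t in (0 : ℝ)..1, f t := by
    rw [intervalIntegral.integral_congr hfK, intervalIntegral.integral_finsetSum fun z _ => hint z]
    simp_rw [hb]
  have hfi : IntervalIntegrable f volume 0 1 := by
    refine (IntervalIntegrable.sum K fun z _ => hint z).congr fun t ht => ?_
    rw [hfK (uIoc_subset_uIcc ht)]
    simp
  have hsymm : ∀ t, f (1 - t) = m - f t := fun t => by
    rw [← hm (t • latptHom ε r), add_sub_cancel_left, ← (Equiv.addRight r).tsum_eq]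
    simp only [hf, Equiv.coe_addRight, map_add, sub_smul, one_smul]
    congr! 3
    abel
  have hrefl : ∫ t in (0 : ℝ)..1, f (1 - t) = ∫ t in (0 : ℝ)..1, f t := by
    simp
  simp_rw [hsymm] at hrefl
  rw [intervalIntegral.integral_sub intervalIntegrable_const hfi] at hrefl
  simp only [intervalIntegral.integral_const, sub_zero, one_smul] at hrefl
  have hval : m / 2 = ∑ x ∈ K, bondInt ε χ x r := by rw [hsum]; linarith
  rw [hval]
  refine hasSum_sum_of_ne_finset_zero fun x hx => ?_
  rw [hb, intervalIntegral.integral_congr (g := fun _ => (0 : ℝ)) fun t ht =>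
    hK x hx _ (hnorm t (by rwa [uIcc_of_le zero_le_one] at ht))]
  simp

/-- For a lattice triangle, the bond integrals of the density function over all lattice translates
of a bond add up to the area of the triangle divided by the area of a lattice cell. -/
theorem hasSum_bondInt_triangle {ε : ℝ} (hε : 0 < ε) (a b c : Fin 2 → ℤ)
    (B : AffineBasis (Fin 3) ℝ (EuclideanSpace ℝ (Fin 2)))
    (h0 : B 0 = latptHom ε a) (h1 : B 1 = latptHom ε b) (h2 : B 2 = latptHom ε c)
    (hχ : IsDensityFn (convexHull ℝ (range B)) χ) (r : Fin 2 → ℤ) :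
    HasSum (fun x => bondInt ε χ x r)
      ((volume (convexHull ℝ (range B))).toReal / ε ^ 2) := by
  have hTb : Bornology.IsBounded (convexHull ℝ (range B)) :=
    ((finite_range B).isCompact_convexHull ℝ).isBounded
  set P := B.floorCoord ⁻¹' {0} with hP
  have hPm : MeasurableSet P := B.measurableSet_floorCoord_fiber
  let ι : ℤ × ℤ →+ (Fin 2 → ℤ) :=
    (zmultiplesHom _ (b - a)).coprod (zmultiplesHom _ (c - a))
  have hι : ∀ x h, B.floorCoord (x + latptHom ε (ι h)) = B.floorCoord x + h := fun x h => by
    rw [← B.floorCoord_add, h0, h1, h2]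
    simp only [ι, AddMonoidHom.coprod_apply, zmultiplesHom_apply, map_add, map_zsmul, map_sub,
      Int.cast_smul_eq_zsmul]
  set m := ∑' z, P.indicator (1 : EuclideanSpace ℝ (Fin 2) → ℝ≥0∞) (0 + latptHom ε z)
  have hm : ∀ x, ∑' z, P.indicator (1 : EuclideanSpace ℝ (Fin 2) → ℝ≥0∞) (x + latptHom ε z) = m :=
    fun x => tsum_indicator_cell_eq (latptHom ε) ι B.floorCoord hι x 0
  have hvolP : volume P = m * ENNReal.ofReal (ε ^ 2) := by
    rw [← measure_latticeCell hε, ← tsum_measure_inter_translate volume (latptHom ε) hPm hm]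
    refine (tsum_measure_inter_fiber volume (latptHom ε) _ (fun x z => ?_) (fun z => ?_) P hPm).symm
    · ext i
      simp [latptHom_apply, latpt_apply, add_div, hε.ne']
    · have : Measurable fun (x : EuclideanSpace ℝ (Fin 2)) (i : Fin 2) => ⌊x i / ε⌋ :=
        measurable_pi_lambda _ fun i => Int.measurable_floor.comp (by fun_prop)
      exact this (measurableSet_singleton z)
  have hvol : 2 * (volume (convexHull ℝ (range B))).toReal = m.toReal * ε ^ 2 := by
    have h := B.measure_inter_add_reflect volume MeasurableSet.univ
    simp only [preimage_univ, inter_univ, ← hP, hvolP, ← two_mul] at h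
    simpa [sq_nonneg] using congrArg ENNReal.toReal h
  have hdens : IsDensityFn P fun q => χ q + χ (B 1 + B 2 - q) := fun q => by
    refine ((hχ q).add (hχ (B 1 + B 2 - q))).congr fun t => ?_
    have hpre : (fun y => B 1 + B 2 - y) ⁻¹' Metric.closedBall q t
        = Metric.closedBall (B 1 + B 2 - q) t := by
      ext y
      simp only [mem_preimage, Metric.mem_closedBall, dist_eq_norm]
      rw [← norm_neg]
      congr! 2
      abel
    have hfin : ∀ S q, volume (S ∩ Metric.closedBall (q : EuclideanSpace ℝ (Fin 2)) t) ≠ ∞ :=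
      fun S q => ((measure_mono inter_subset_right).trans_lt
        (isCompact_closedBall q t).measure_lt_top).ne
    rw [Measure.addHaar_closedBall_center volume (B 1 + B 2 - q),
      ← Measure.addHaar_closedBall_center volume q, ← add_div,
      ← ENNReal.toReal_add (hfin _ _) (hfin _ _), ← hpre,
      B.measure_inter_add_reflect volume measurableSet_closedBall]
  have hsum : ∀ p, ∑' z, χ (p + latptHom ε z) + ∑' z, χ (-p + latptHom ε z) = m.toReal :=
    fun p => by
    rw [← hdens.tsum_eq hε B.isBounded_floorCoord_fiber hPm hm p]
    have hrefl : ∀ z, B 1 + B 2 - (p + latptHom ε z)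
        = -p + latptHom ε (Equiv.subLeft (b + c) z) := fun z => by
      rw [h1, h2, Equiv.subLeft_apply, map_sub, map_add]
      abel
    simp_rw [hrefl]
    have hs : Summable fun z => χ (-p + latptHom ε (Equiv.subLeft (b + c) z)) :=
      (Equiv.subLeft (b + c)).summable_iff.2 (hχ.summable hε hTb (-p))
    rw [(hχ.summable hε hTb p).tsum_add hs, (Equiv.subLeft (b + c)).tsum_eq fun z => χ (-p + latptHom ε z)]
  convert hχ.tsum_bondInt hε hTb B.measurableSet_convexHull hsum r using 1
  field_simp
  linarith

end Plane

end BondDensity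

/-- Atomistic stress of a homogeneous deformation:
`Σ_{r∈ℛ} (ε²/|T|) Σ_{x∈εℤ²} [∂_r V(Fℛ) ⊗ r] ⨍_x^{x+εr} χ_T db = Σ_{r∈ℛ} ∂_r V(Fℛ) ⊗ r`,
i.e. `Σ_a(y_F; T) = ∂W(F)`. -/
theorem stmt_11 (N : ℕ) (hN : 1 ≤ N)
    (R : Finset (Fin 2 → ℤ)) (hR : (0 : Fin 2 → ℤ) ∉ R)
    (V : (R → EuclideanSpace ℝ (Fin 2)) → ℝ) (hV : ContDiff ℝ 1 V)
    (DV : (R → EuclideanSpace ℝ (Fin 2)) → R → EuclideanSpace ℝ (Fin 2))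
    (hDV : ∀ (g : R → EuclideanSpace ℝ (Fin 2)) (r : R) (a : EuclideanSpace ℝ (Fin 2)),
      ⟪DV g r, a⟫ = fderiv ℝ V g (Pi.single r a))
    (a b c : Fin 2 → ℤ)
    (hnd : AffineIndependent ℝ
      ![latpt (1 / (N : ℝ)) a, latpt (1 / (N : ℝ)) b, latpt (1 / (N : ℝ)) c])
    (χ : EuclideanSpace ℝ (Fin 2) → ℝ)
    (hχ : IsDensityFn
      (convexHull ℝ {latpt (1 / (N : ℝ)) a, latpt (1 / (N : ℝ)) b, latpt (1 / (N : ℝ)) c}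
        : Set (EuclideanSpace ℝ (Fin 2))) χ)
    (F : Mat2) :
    (∑ r : R, ((1 / (N : ℝ)) ^ 2
          / (volume (convexHull ℝ
              {latpt (1 / (N : ℝ)) a, latpt (1 / (N : ℝ)) b, latpt (1 / (N : ℝ)) c}
              : Set (EuclideanSpace ℝ (Fin 2)))).toReal)
        • (∑' x : Fin 2 → ℤ,
            bondInt (1 / (N : ℝ)) χ x (↑r) • outer (DV (stencil R F) r) (↑r)))
      = ∑ r : R, outer (DV (stencil R F) r) (↑r) := by
  have hε : (0 : ℝ) < 1 / (N : ℝ) := by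
    have : (0 : ℝ) < N := by exact_mod_cast hN
    positivity
  let B : AffineBasis (Fin 3) ℝ (EuclideanSpace ℝ (Fin 2)) :=
    ⟨_, hnd, hnd.affineSpan_eq_top_iff_card_eq_finrank_add_one.2 (by simp)⟩
  have hB : convexHull ℝ {latpt (1 / (N : ℝ)) a, latpt (1 / (N : ℝ)) b, latpt (1 / (N : ℝ)) c}
      = convexHull ℝ (Set.range B) := by
    congr 1
    change _ = Set.range ![latpt (1 / (N : ℝ)) a, latpt (1 / (N : ℝ)) b, latpt (1 / (N : ℝ)) c]
    simp only [Matrix.range_cons, Matrix.range_empty, Set.union_empty, Set.insert_eq]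
  rw [hB] at hχ ⊢
  have hpos : 0 < (volume (convexHull ℝ (Set.range B))).toReal :=
    ENNReal.toReal_pos
      (Measure.measure_pos_of_nonempty_interior _ ⟨_, B.centroid_mem_interior_convexHull⟩).ne'
      ((Set.finite_range B).isCompact_convexHull ℝ).measure_lt_top.ne
  refine Finset.sum_congr rfl fun r _ => ?_
  have hsum := hasSum_bondInt_triangle hε a b c B rfl rfl rfl hχ r
  rw [(hsum.smul_const _).tsum_eq, smul_smul]
  convert one_smul ℝ _
  field_simp
end
end
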